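/- arXiv:2102.06028 — 3 statements merged into one kernel-verified Lean document; each statement's English description precedes it below -/
import Mathlib

section
/- In the nominal channel-free TCP system G_nom (Peer A and Peer B with timeout, composed with the nominal network), no reachable global state has Peer A in state 'closed' and simultaneously Peer B in state 'established'; i.e., for every string s ∈ L(G_nom), the state reached after s does not satisfy (A = closed ∧ B = established). Hence Threat Model 1 is not violated without an attacker. -/
/-! Channel-free model of TCP connection establishment (three-way handshake):
Peer A and Peer B (with timeout), composed synchronously with a network automaton. -/

/-- Packet types. -/
inductive Pkt | syn | ack | fin | synack deriving DecidableEq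

/-- Events of the channel-free TCP system: `an m` = packet `m` sent from Peer A to the
network, `na m` = from the network to Peer A, `bn m` = from Peer B to the network,
`nb m` = from the network to Peer B, plus the private peer events. -/
inductive Ev
  | an : Pkt → Ev
  | na : Pkt → Ev
  | bn : Pkt → Ev
  | nb : Pkt → Ev
  | listenA | listenB | timeoutA | timeoutB | delA | delB
  deriving DecidableEq

/-- TCP peer states. -/
inductive PSt
  | closed | synsent | listen | i0 | i1 | i2 | established | synreceived | i3
  | closewait | lastack | finwait1 | finwait2 | i4 | i5 | closing | timewait
  deriving DecidableEq

/-- TCP peer transitions (with timeout), parametrized by the peer's send events `snd`,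
receive events `rcv`, and private events `lst`, `tmo`, `del`. -/
def peerTrans (snd rcv : Pkt → Ev) (lst tmo del : Ev) : List (PSt × Ev × PSt) :=
  [(.closed, snd .syn, .synsent), (.synsent, rcv .synack, .i0), (.i0, snd .ack, .established),
   (.synsent, rcv .syn, .i1), (.i1, snd .ack, .synreceived),
   (.synreceived, rcv .ack, .established),
   (.closed, lst, .listen), (.listen, tmo, .closed), (.listen, rcv .syn, .i2),
   (.i2, snd .synack, .synreceived),
   (.established, rcv .fin, .i3), (.i3, snd .ack, .closewait),
   (.closewait, snd .fin, .lastack), (.lastack, rcv .ack, .closed),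
   (.established, snd .fin, .finwait1), (.finwait1, rcv .ack, .finwait2),
   (.finwait1, rcv .fin, .i4), (.finwait2, rcv .fin, .i5),
   (.i4, snd .ack, .closing), (.closing, rcv .ack, .closed),
   (.i5, snd .ack, .timewait), (.timewait, del, .closed)]

/-- A peer's alphabet. -/
def peerAlph (snd rcv : Pkt → Ev) (lst tmo del : Ev) (e : Ev) : Prop :=
  (∃ m, e = snd m) ∨ (∃ m, e = rcv m) ∨ e = lst ∨ e = tmo ∨ e = del

/-- Peer A: sends `an m`, receives `na m`. -/
def peerAStep (q : PSt) (e : Ev) (q' : PSt) : Prop :=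
  (q, e, q') ∈ peerTrans Ev.an Ev.na .listenA .timeoutA .delA
def peerAAlph : Ev → Prop := peerAlph Ev.an Ev.na .listenA .timeoutA .delA

/-- Peer B: sends `bn m`, receives `nb m`. -/
def peerBStep (q : PSt) (e : Ev) (q' : PSt) : Prop :=
  (q, e, q') ∈ peerTrans Ev.bn Ev.nb .listenB .timeoutB .delB
def peerBAlph : Ev → Prop := peerAlph Ev.bn Ev.nb .listenB .timeoutB .delB

/-- Network states: `init`, plus a state `qa m` / `qb m` per packet in transit. -/
inductive NSt | init | qa : Pkt → NSt | qb : Pkt → NSt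
  deriving DecidableEq

/-- The network alphabet: all packet events. -/
def netAlph (e : Ev) : Prop :=
  (∃ m, e = Ev.an m) ∨ (∃ m, e = Ev.na m) ∨ (∃ m, e = Ev.bn m) ∨ (∃ m, e = Ev.nb m)

/-- Nominal network transitions. -/
def netTransNom (q : NSt) (e : Ev) (q' : NSt) : Prop :=
  (∃ m, q = .init ∧ e = .an m ∧ q' = .qa m) ∨
  (∃ m, q = .qa m ∧ e = .nb m ∧ q' = .init) ∨
  (∃ m, q = .init ∧ e = .bn m ∧ q' = .qb m) ∨
  (∃ m, q = .qb m ∧ e = .na m ∧ q' = .init)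

/-- The attacker's controllable events: the outgoing packets of the network. -/
def ATTK : Set Ev := {e | ∃ m, e = Ev.na m ∨ e = Ev.nb m}

/-- Attacked network transitions: from any non-initial state the attacker may emit any
event of `ATTK`. -/
def netTransAtk (q : NSt) (e : Ev) (q' : NSt) : Prop :=
  (∃ m, q = .init ∧ e = .an m ∧ q' = .qa m) ∨
  (∃ m, q = .init ∧ e = .bn m ∧ q' = .qb m) ∨
  ((∃ m, q = .qa m ∨ q = .qb m) ∧ e ∈ ATTK ∧ q' = .init)

/-- Synchronization of one component: if the event is in the component's alphabet, the
component must execute a transition on it; otherwise the component does not move. -/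
def sync {Q : Type*} (alph : Ev → Prop) (trans : Q → Ev → Q → Prop)
    (q : Q) (e : Ev) (q' : Q) : Prop :=
  (alph e ∧ trans q e q') ∨ (¬ alph e ∧ q' = q)

/-- Global states of the channel-free TCP system. -/
structure GSt where
  pa : PSt
  pb : PSt
  net : NSt
  deriving DecidableEq

/-- Global step of the synchronous composition, parametrized by the network. -/
def gstep (net : NSt → Ev → NSt → Prop) (q : GSt) (e : Ev) (q' : GSt) : Prop :=
  sync peerAAlph peerAStep q.pa e q'.pa ∧
  sync peerBAlph peerBStep q.pb e q'.pb ∧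
  sync netAlph net q.net e q'.net

/-- Runs of the composition. -/
inductive Reach (step : GSt → Ev → GSt → Prop) (q0 : GSt) : List Ev → GSt → Prop
  | nil : Reach step q0 [] q0
  | snoc {s : List Ev} {q : GSt} {e : Ev} {q' : GSt} :
      Reach step q0 s q → step q e q' → Reach step q0 (s ++ [e]) q'

/-- Initial global state. -/
def init : GSt := ⟨.closed, .closed, .init⟩

/-- Generated language. -/
def Lang (step : GSt → Ev → GSt → Prop) : Set (List Ev) :=
  {s | ∃ q, Reach step init s q}

/-- The reachable global states of the nominal system, as triples of component states. -/
def reachableTriples : List (PSt × PSt × NSt) :=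
  [(.closed, .closed, .init), (.synsent, .closed, .qa .syn), (.listen, .closed, .init),
   (.closed, .synsent, .qb .syn), (.closed, .listen, .init), (.synsent, .listen, .qa .syn),
   (.listen, .synsent, .qb .syn), (.listen, .listen, .init), (.synsent, .i2, .init),
   (.i2, .synsent, .init), (.synsent, .synreceived, .qb .synack),
   (.synreceived, .synsent, .qa .synack), (.i0, .synreceived, .init), (.synreceived, .i0, .init),
   (.established, .synreceived, .qa .ack), (.synreceived, .established, .qb .ack),
   (.established, .established, .init), (.finwait1, .established, .qa .fin),
   (.established, .finwait1, .qb .fin), (.finwait1, .i3, .init), (.i3, .finwait1, .init),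
   (.finwait1, .closewait, .qb .ack), (.closewait, .finwait1, .qa .ack),
   (.finwait2, .closewait, .init), (.closewait, .finwait2, .init),
   (.finwait2, .lastack, .qb .fin), (.lastack, .finwait2, .qa .fin), (.i5, .lastack, .init),
   (.lastack, .i5, .init), (.timewait, .lastack, .qa .ack), (.lastack, .timewait, .qb .ack),
   (.closed, .lastack, .qa .ack), (.timewait, .closed, .init), (.closed, .timewait, .init),
   (.lastack, .closed, .qb .ack), (.listen, .lastack, .qa .ack), (.timewait, .synsent, .qb .syn),
   (.timewait, .listen, .init), (.synsent, .timewait, .qa .syn), (.listen, .timewait, .init),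
   (.lastack, .listen, .qb .ack)]

theorem mem_reachableTriples_of_gstep {q q' : GSt} {e : Ev}
    (hq : (q.pa, q.pb, q.net) ∈ reachableTriples) (h : gstep netTransNom q e q') :
    (q'.pa, q'.pb, q'.net) ∈ reachableTriples := by
  obtain ⟨a, b, n⟩ := q
  obtain ⟨a', b', n'⟩ := q'
  rcases e with m | m | m | m | _ | _ | _ | _ | _ | _ <;> (try cases m) <;>
    simp [gstep, sync, peerAAlph, peerBAlph, peerAlph, peerAStep, peerBStep, peerTrans, netAlph,
      netTransNom] at h <;>
    casesm* _ ∨ _, _ ∧ _ <;> subst_vars <;>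
    simp [reachableTriples] at hq ⊢ <;>
    grind

theorem mem_reachableTriples_of_reach {s : List Ev} {q : GSt}
    (h : Reach (gstep netTransNom) init s q) : (q.pa, q.pb, q.net) ∈ reachableTriples := by
  induction h with
  | nil => simp [init, reachableTriples]
  | snoc _ hstep ih => exact mem_reachableTriples_of_gstep ih hstep

/-- in the nominal channel-free TCP system `G_nom`, no reachable
global state has Peer A at `closed` and simultaneously Peer B at `established`:
Threat Model 1 is not violated without an attacker. -/
theorem stmt11 (s : List Ev) (q : GSt) (h : Reach (gstep netTransNom) init s q) :
    ¬ (q.pa = PSt.closed ∧ q.pb = PSt.established) := by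
  rintro ⟨ha, hb⟩
  have hq := mem_reachableTriples_of_reach h
  simp [ha, hb, reachableTriples] at hq
end

section
/- In the attacked channel-free TCP system G_a (Peer A and Peer B with timeout, composed with the attacked network), with uncontrollable events Σ_uc = Σ \ ATTK where ATTK = { m_NA, m_NB : m ∈ {SYN, ACK, FIN, SYN_ACK} }, and observable events Σ_o = { m_AN, m_BN, m_NA, m_NB : m } with natural projection P, the string SYN_BN · SYN_NB · ACK_BN · ACK_NB belongs to L(G_a) and the state reached after it has Peer A at 'closed' and Peer B at 'established'. Moreover, letting M_TM1 = { s ∈ L(G_a) : the state reached after s has A = closed and B = established }, there exists a nonempty sublanguage K ⊆ M_TM1 that is controllable with respect to (L(G_a), Σ_uc) and normal with respect to (L(G_a), P); hence a For-all attack against Threat Model 1 exists in the channel-free setup. -/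
/-! Abstract supervisory-control notions on languages. -/

/-- Prefix closure `pr(K)`. -/
def prefixClosure {A : Type*} (K : Set (List A)) : Set (List A) := {s | ∃ t ∈ K, s <+: t}

/-- Controllability of `K` w.r.t. `(L, Auc)`. -/
def IsControllable {A : Type*} (K L : Set (List A)) (Auc : Set A) : Prop :=
  ∀ s ∈ prefixClosure K, ∀ σ ∈ Auc, s ++ [σ] ∈ L → s ++ [σ] ∈ prefixClosure K

/-- Normality of `K` w.r.t. `(L, P)`: `pr(K) = P⁻¹(P(pr(K))) ∩ L`. -/
def IsNormalLang {A : Type*} (K L : Set (List A)) (P : List A → List A) : Prop :=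
  prefixClosure K = {s | ∃ t ∈ prefixClosure K, P s = P t} ∩ L

/-- The attacked channel-free TCP system `G_a`. -/
def atkStep : GSt → Ev → GSt → Prop := gstep netTransAtk

/-- Natural projection onto the attacker's observable events
`Eo = { m_AN, m_BN, m_NA, m_NB }` (all packet events). -/
def P (s : List Ev) : List Ev :=
  s.filter (fun e => match e with
    | .an _ => true | .na _ => true | .bn _ => true | .nb _ => true
    | _ => false)

/-- Violation of Threat Model 1: strings after which Peer A is at `closed` while Peer B
is at `established`. -/
def MTM1 : Set (List Ev) :=
  {s | ∃ q : GSt, Reach atkStep init s q ∧ q.pa = PSt.closed ∧ q.pb = PSt.established}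

/-- Transition function of the network that reflects every packet back to its sender. -/
def echoNext : NSt → Ev → Option NSt
  | .init, .an m => some (.qa m)
  | .init, .bn m => some (.qb m)
  | .qa m, .na m' => if m = m' then some .init else none
  | .qb m, .nb m' => if m = m' then some .init else none
  | _, _ => none

/-- The TCP system composed with the reflecting network. -/
def echoStep : GSt → Ev → GSt → Prop := gstep fun n e n' => echoNext n e = some n'

lemma netTransAtk_of_echoNext {n n' : NSt} {e : Ev} (h : echoNext n e = some n') :
    netTransAtk n e n' := by
  rcases n with _ | m | m <;> cases e <;>
    simp_all [echoNext, netTransAtk, ATTK, eq_comm]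

lemma atkStep_of_echoStep {q q' : GSt} {e : Ev} (h : echoStep q e q') : atkStep q e q' :=
  ⟨h.1, h.2.1, h.2.2.imp_left fun hn => ⟨hn.1, netTransAtk_of_echoNext hn.2⟩⟩

lemma echoNext_of_netTransAtk {n n' : NSt} {e : Ev} (h : netTransAtk n e n') (he : e ∉ ATTK) :
    echoNext n e = some n' := by
  rcases h with ⟨m, rfl, rfl, rfl⟩ | ⟨m, rfl, rfl, rfl⟩ | ⟨-, h, -⟩
  · rfl
  · rfl
  · exact absurd h he

lemma eq_of_netTransAtk_of_echoNext {n n' n'' : NSt} {e : Ev} (h : netTransAtk n e n')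
    (h' : echoNext n e = some n'') : n' = n'' := by
  by_cases he : e ∈ ATTK
  · obtain ⟨m, rfl | rfl⟩ := he <;> rcases n with _ | k | k <;>
      simp_all [echoNext, netTransAtk]
  · exact Option.some_inj.1 ((echoNext_of_netTransAtk h he).symm.trans h')

lemma echoStep_of_atkStep {q q' : GSt} {e : Ev} (h : atkStep q e q') (he : e ∉ ATTK) :
    echoStep q e q' :=
  ⟨h.1, h.2.1, h.2.2.imp_left fun hn => ⟨hn.1, echoNext_of_netTransAtk hn.2 he⟩⟩

section Reach

variable {step step' : GSt → Ev → GSt → Prop} {q₀ : GSt}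

lemma reach_nil_iff {q : GSt} : Reach step q₀ [] q ↔ q = q₀ := by
  constructor
  · generalize ht : ([] : List Ev) = t
    rintro (_ | _)
    · rfl
    · simp at ht
  · rintro rfl
    exact .nil

lemma reach_append_singleton_iff {s : List Ev} {e : Ev} {q' : GSt} :
    Reach step q₀ (s ++ [e]) q' ↔ ∃ q, Reach step q₀ s q ∧ step q e q' := by
  constructor
  · generalize ht : s ++ [e] = t
    rintro (_ | ⟨hr, hs⟩)
    · simp at ht
    · obtain ⟨rfl, h⟩ := List.append_inj' ht rfl
      obtain rfl := List.singleton_inj.1 h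
      exact ⟨_, hr, hs⟩
  · rintro ⟨q, hr, hs⟩
    exact hr.snoc hs

lemma Reach.mono (hstep : ∀ {q e q'}, step q e q' → step' q e q') {s : List Ev} {q : GSt}
    (h : Reach step q₀ s q) : Reach step' q₀ s q := by
  induction h with
  | nil => exact .nil
  | snoc _ hs ih => exact ih.snoc (hstep hs)

lemma Reach.exists_of_append {s t : List Ev} {q : GSt} (h : Reach step q₀ (s ++ t) q) :
    ∃ q', Reach step q₀ s q' := by
  induction t using List.reverseRecOn generalizing q with
  | nil => exact ⟨q, by simpa using h⟩
  | append_singleton t e ih =>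
    rw [← List.append_assoc, reach_append_singleton_iff] at h
    obtain ⟨q', h', -⟩ := h
    exact ih h'

lemma Reach.exists_append {s : List Ev} {q q' : GSt} (h : Reach step q₀ s q)
    (hq : Relation.ReflTransGen (fun a b => ∃ e, step a e b) q q') :
    ∃ t, Reach step q₀ (s ++ t) q' := by
  induction hq with
  | refl => exact ⟨[], by simpa using h⟩
  | tail _ hs ih =>
    obtain ⟨t, ht⟩ := ih
    obtain ⟨e, he⟩ := hs
    exact ⟨t ++ [e], by simpa using ht.snoc he⟩

end Reach

lemma P_append_of_netAlph (s : List Ev) {e : Ev} (he : netAlph e) : P (s ++ [e]) = P s ++ [e] := by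
  rcases he with ⟨m, rfl⟩ | ⟨m, rfl⟩ | ⟨m, rfl⟩ | ⟨m, rfl⟩ <;> simp [P]

lemma P_append_of_not_netAlph (s : List Ev) {e : Ev} (he : ¬ netAlph e) : P (s ++ [e]) = P s := by
  cases e <;> simp_all [P, netAlph]

/-- In the reflecting system the network state is determined by the observations. -/
lemma Reach.foldlM_echoNext {s : List Ev} {q : GSt} (h : Reach echoStep init s q) :
    (P s).foldlM echoNext .init = some q.net := by
  induction h with
  | nil => rfl
  | snoc _ hs ih =>
    rcases hs.2.2 with ⟨he, hn⟩ | ⟨he, hn⟩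
    · simp [P_append_of_netAlph _ he, List.foldlM_append, ih, hn]
    · rw [P_append_of_not_netAlph _ he, ih, hn]

/-- A run of the attacked system whose observations are consistent with reflection is a run of
the reflecting system. -/
lemma Reach.echo_of_foldlM {s : List Ev} {q : GSt} (h : Reach atkStep init s q) {n : NSt}
    (hn : (P s).foldlM echoNext .init = some n) : Reach echoStep init s q := by
  induction h generalizing n with
  | nil => exact .nil
  | @snoc s q e q' _ hs ih =>
    rcases hs.2.2 with ⟨he, ht⟩ | ⟨he, ht⟩
    · rw [P_append_of_netAlph _ he, List.foldlM_append] at hn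
      obtain ⟨n₁, h₁, h₂⟩ := Option.bind_eq_some_iff.1 hn
      have hr := ih h₁
      have hq : q.net = n₁ := Option.some_inj.1 (hr.foldlM_echoNext.symm.trans h₁)
      have h₃ : echoNext q.net e = some n := by simpa [hq] using h₂
      have hn' : q'.net = n := eq_of_netTransAtk_of_echoNext ht h₃
      exact hr.snoc ⟨hs.1, hs.2.1, .inl ⟨he, hn'.symm ▸ h₃⟩⟩
    · rw [P_append_of_not_netAlph _ he] at hn
      exact (ih hn).snoc ⟨hs.1, hs.2.1, .inr ⟨he, ht⟩⟩

/-- Peer states visited by the reflecting system while no packet of that peer is in transit. -/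
def Idle (p : PSt) : Prop :=
  p = .closed ∨ p = .listen ∨ p = .i1 ∨ p = .established ∨ p = .i4

/-- Peer states visited by the reflecting system while the packet `m` of that peer is in
transit. -/
def Awaiting (p : PSt) (m : Pkt) : Prop :=
  (p = .synsent ∧ m = .syn) ∨ (p = .synreceived ∧ m = .ack) ∨ (p = .finwait1 ∧ m = .fin) ∨
    (p = .closing ∧ m = .ack)

/-- Invariant of the reflecting system. -/
def EchoInv (q : GSt) : Prop :=
  match q.net with
  | .init => Idle q.pa ∧ Idle q.pb
  | .qa m => Awaiting q.pa m ∧ Idle q.pb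
  | .qb m => Idle q.pa ∧ Awaiting q.pb m

lemma echoInv_of_echoStep {q q' : GSt} {e : Ev} (hq : EchoInv q) (h : echoStep q e q') :
    EchoInv q' := by
  obtain ⟨pa, pb, n⟩ := q
  obtain ⟨pa', pb', n'⟩ := q'
  obtain ⟨ha, hb, hn⟩ := h
  rcases n with _ | k | k <;> cases e <;>
    simp_all [sync, peerAAlph, peerBAlph, peerAlph, netAlph, echoNext] <;>
    simp only [EchoInv, peerAStep, peerBStep, peerTrans, List.mem_cons, Prod.mk.injEq] at * <;>
    grind [Idle, Awaiting]

lemma Reach.echoInv {s : List Ev} {q : GSt} (h : Reach echoStep init s q) : EchoInv q := by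
  induction h with
  | nil => simp [EchoInv, init, Idle]
  | snoc _ hs ih => exact echoInv_of_echoStep ih hs

/-- `EchoReaches q q'`: the reflecting system can move from `q` to `q'`. -/
abbrev EchoReaches : GSt → GSt → Prop := Relation.ReflTransGen fun a b => ∃ e, echoStep a e b

lemma echoStep_an {p p' x : PSt} {m : Pkt} (h : peerAStep p (.an m) p') :
    echoStep ⟨p, x, .init⟩ (.an m) ⟨p', x, .qa m⟩ := by
  simp [echoStep, gstep, sync, peerAAlph, peerBAlph, peerAlph, netAlph, echoNext, h]

lemma echoStep_na {p p' x : PSt} {m : Pkt} (h : peerAStep p (.na m) p') :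
    echoStep ⟨p, x, .qa m⟩ (.na m) ⟨p', x, .init⟩ := by
  simp [echoStep, gstep, sync, peerAAlph, peerBAlph, peerAlph, netAlph, echoNext, h]

lemma echoStep_bn {p p' x : PSt} {m : Pkt} (h : peerBStep p (.bn m) p') :
    echoStep ⟨x, p, .init⟩ (.bn m) ⟨x, p', .qb m⟩ := by
  simp [echoStep, gstep, sync, peerAAlph, peerBAlph, peerAlph, netAlph, echoNext, h]

lemma echoStep_nb {p p' x : PSt} {m : Pkt} (h : peerBStep p (.nb m) p') :
    echoStep ⟨x, p, .qb m⟩ (.nb m) ⟨x, p', .init⟩ := by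
  simp [echoStep, gstep, sync, peerAAlph, peerBAlph, peerAlph, netAlph, echoNext, h]

lemma echoReaches_exchangeA {p p' p'' : PSt} (x : PSt) {m : Pkt} (h : peerAStep p (.an m) p')
    (h' : peerAStep p' (.na m) p'') : EchoReaches ⟨p, x, .init⟩ ⟨p'', x, .init⟩ :=
  .tail (.single ⟨_, echoStep_an h⟩) ⟨_, echoStep_na h'⟩

lemma echoReaches_exchangeB {p p' p'' : PSt} (x : PSt) {m : Pkt} (h : peerBStep p (.bn m) p')
    (h' : peerBStep p' (.nb m) p'') : EchoReaches ⟨x, p, .init⟩ ⟨x, p'', .init⟩ :=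
  .tail (.single ⟨_, echoStep_bn h⟩) ⟨_, echoStep_nb h'⟩

lemma echoReaches_closed_of_idle {p : PSt} (hp : Idle p) (x : PSt) :
    EchoReaches ⟨p, x, .init⟩ ⟨.closed, x, .init⟩ := by
  have h₁ : EchoReaches ⟨.i1, x, .init⟩ ⟨.established, x, .init⟩ :=
    echoReaches_exchangeA (m := .ack) (p' := .synreceived) x
      (by simp [peerAStep, peerTrans]) (by simp [peerAStep, peerTrans])
  have h₂ : EchoReaches ⟨.established, x, .init⟩ ⟨.i4, x, .init⟩ :=
    echoReaches_exchangeA (m := .fin) (p' := .finwait1) x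
      (by simp [peerAStep, peerTrans]) (by simp [peerAStep, peerTrans])
  have h₃ : EchoReaches ⟨.i4, x, .init⟩ ⟨.closed, x, .init⟩ :=
    echoReaches_exchangeA (m := .ack) (p' := .closing) x
      (by simp [peerAStep, peerTrans]) (by simp [peerAStep, peerTrans])
  rcases hp with rfl | rfl | rfl | rfl | rfl
  · exact .refl
  · exact .single ⟨.timeoutA, by
      simp [echoStep, gstep, sync, peerAAlph, peerBAlph, peerAlph, netAlph, peerAStep, peerTrans]⟩
  · exact h₁.trans (h₂.trans h₃)
  · exact h₂.trans h₃
  · exact h₃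

lemma echoReaches_established_of_idle {p : PSt} (hp : Idle p) (x : PSt) :
    EchoReaches ⟨x, p, .init⟩ ⟨x, .established, .init⟩ := by
  have h₁ : EchoReaches ⟨x, .i1, .init⟩ ⟨x, .established, .init⟩ :=
    echoReaches_exchangeB (m := .ack) (p' := .synreceived) x
      (by simp [peerBStep, peerTrans]) (by simp [peerBStep, peerTrans])
  have h₂ : EchoReaches ⟨x, .closed, .init⟩ ⟨x, .i1, .init⟩ :=
    echoReaches_exchangeB (m := .syn) (p' := .synsent) x
      (by simp [peerBStep, peerTrans]) (by simp [peerBStep, peerTrans])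
  have h₃ : EchoReaches ⟨x, .i4, .init⟩ ⟨x, .closed, .init⟩ :=
    echoReaches_exchangeB (m := .ack) (p' := .closing) x
      (by simp [peerBStep, peerTrans]) (by simp [peerBStep, peerTrans])
  rcases hp with rfl | rfl | rfl | rfl | rfl
  · exact h₂.trans h₁
  · refine .head ⟨.timeoutB, ?_⟩ (h₂.trans h₁)
    simp [echoStep, gstep, sync, peerAAlph, peerBAlph, peerAlph, netAlph, peerBStep, peerTrans]
  · exact h₁
  · exact .refl
  · exact h₃.trans (h₂.trans h₁)

lemma Awaiting.exists_peerAStep {p : PSt} {m : Pkt} (h : Awaiting p m) :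
    ∃ p', Idle p' ∧ peerAStep p (.na m) p' := by
  rcases h with ⟨rfl, rfl⟩ | ⟨rfl, rfl⟩ | ⟨rfl, rfl⟩ | ⟨rfl, rfl⟩ <;>
    simp [Idle, peerAStep, peerTrans]

lemma Awaiting.exists_peerBStep {p : PSt} {m : Pkt} (h : Awaiting p m) :
    ∃ p', Idle p' ∧ peerBStep p (.nb m) p' := by
  rcases h with ⟨rfl, rfl⟩ | ⟨rfl, rfl⟩ | ⟨rfl, rfl⟩ | ⟨rfl, rfl⟩ <;>
    simp [Idle, peerBStep, peerTrans]

/-- The reflecting system can always reach the violation of Threat Model 1. -/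
lemma EchoInv.echoReaches {q : GSt} (h : EchoInv q) :
    EchoReaches q ⟨.closed, .established, .init⟩ := by
  have key {a b : PSt} (ha : Idle a) (hb : Idle b) :
      EchoReaches ⟨a, b, .init⟩ ⟨.closed, .established, .init⟩ :=
    (echoReaches_closed_of_idle ha b).trans (echoReaches_established_of_idle hb _)
  obtain ⟨a, b, _ | m | m⟩ := q
  · exact key h.1 h.2
  · obtain ⟨a', ha', hs⟩ := h.1.exists_peerAStep
    exact .head ⟨_, echoStep_na hs⟩ (key ha' h.2)
  · obtain ⟨b', hb', hs⟩ := h.2.exists_peerBStep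
    exact .head ⟨_, echoStep_nb hs⟩ (key h.1 hb')

lemma prefixClosure_MTM1_inter_Lang_echoStep :
    prefixClosure (MTM1 ∩ Lang echoStep) = Lang echoStep := by
  ext s
  constructor
  · rintro ⟨_, ⟨-, q, hq⟩, t, rfl⟩
    exact hq.exists_of_append
  · rintro ⟨q, hq⟩
    obtain ⟨t, ht⟩ := hq.exists_append hq.echoInv.echoReaches
    exact ⟨s ++ t, ⟨⟨_, ht.mono atkStep_of_echoStep, rfl, rfl⟩, _, ht⟩, List.prefix_append s t⟩

lemma isControllable_MTM1_inter_Lang_echoStep :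
    IsControllable (MTM1 ∩ Lang echoStep) (Lang atkStep) ATTKᶜ := by
  rw [IsControllable, prefixClosure_MTM1_inter_Lang_echoStep]
  rintro s ⟨q, hq⟩ e he ⟨q', h⟩
  obtain ⟨q₁, h₁, hs⟩ := reach_append_singleton_iff.1 h
  exact ⟨q', (h₁.echo_of_foldlM hq.foldlM_echoNext).snoc (echoStep_of_atkStep hs he)⟩

lemma isNormalLang_MTM1_inter_Lang_echoStep :
    IsNormalLang (MTM1 ∩ Lang echoStep) (Lang atkStep) P := by
  rw [IsNormalLang, prefixClosure_MTM1_inter_Lang_echoStep]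
  ext s
  constructor
  · rintro ⟨q, hq⟩
    exact ⟨⟨s, ⟨q, hq⟩, rfl⟩, q, hq.mono atkStep_of_echoStep⟩
  · rintro ⟨⟨t, ⟨q', ht⟩, hst⟩, q, hq⟩
    exact ⟨q, hq.echo_of_foldlM (hst ▸ ht.foldlM_echoNext)⟩

lemma reach_echoStep_handshake :
    Reach echoStep init [.bn .syn, .nb .syn, .bn .ack, .nb .ack]
      ⟨.closed, .established, .init⟩ := by
  have h₁ : Reach echoStep init [.bn .syn] ⟨.closed, .synsent, .qb .syn⟩ :=
    Reach.nil.snoc (echoStep_bn (by simp [peerBStep, peerTrans]))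
  have h₂ : Reach echoStep init [.bn .syn, .nb .syn] ⟨.closed, .i1, .init⟩ :=
    h₁.snoc (echoStep_nb (by simp [peerBStep, peerTrans]))
  have h₃ : Reach echoStep init [.bn .syn, .nb .syn, .bn .ack] ⟨.closed, .synreceived, .qb .ack⟩ :=
    h₂.snoc (echoStep_bn (by simp [peerBStep, peerTrans]))
  exact h₃.snoc (echoStep_nb (by simp [peerBStep, peerTrans]))

lemma reach_atkStep_handshake {q : GSt}
    (h : Reach atkStep init [.bn .syn, .nb .syn, .bn .ack, .nb .ack] q) :
    q.pa = .closed ∧ q.pb = .established := by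
  obtain ⟨q₃, h, s₄⟩ := (reach_append_singleton_iff (s := [.bn .syn, .nb .syn, .bn .ack])).1 h
  obtain ⟨q₂, h, s₃⟩ := (reach_append_singleton_iff (s := [.bn .syn, .nb .syn])).1 h
  obtain ⟨q₁, h, s₂⟩ := (reach_append_singleton_iff (s := [.bn .syn])).1 h
  obtain ⟨q₀, h, s₁⟩ := (reach_append_singleton_iff (s := [])).1 h
  obtain rfl := reach_nil_iff.1 h
  replace s₁ : q₁.pa = .closed ∧ q₁.pb = .synsent := by
    simpa [peerAAlph, peerBAlph, peerAlph, sync, peerBStep, peerTrans, init] using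
      And.intro s₁.1 s₁.2.1
  replace s₂ : q₂.pa = .closed ∧ q₂.pb = .i1 := by
    simpa [peerAAlph, peerBAlph, peerAlph, sync, peerBStep, peerTrans, s₁] using
      And.intro s₂.1 s₂.2.1
  replace s₃ : q₃.pa = .closed ∧ q₃.pb = .synreceived := by
    simpa [peerAAlph, peerBAlph, peerAlph, sync, peerBStep, peerTrans, s₂] using
      And.intro s₃.1 s₃.2.1
  simpa [peerAAlph, peerBAlph, peerAlph, sync, peerBStep, peerTrans, s₃] using
    And.intro s₄.1 s₄.2.1

/-- the string `SYN_BN · SYN_NB · ACK_BN · ACK_NB` belongs to `L(G_a)`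
and leads to a state with Peer A at `closed` and Peer B at `established`; moreover there
is a nonempty sublanguage `K ⊆ M_TM1` controllable w.r.t. `(L(G_a), Σ \ ATTK)` and
normal w.r.t. `(L(G_a), P)`: a For-all attack against Threat Model 1 exists in the
channel-free setup. -/
theorem stmt15 :
    ([.bn .syn, .nb .syn, .bn .ack, .nb .ack] : List Ev) ∈ Lang atkStep ∧
    (∀ q : GSt, Reach atkStep init [.bn .syn, .nb .syn, .bn .ack, .nb .ack] q →
      q.pa = PSt.closed ∧ q.pb = PSt.established) ∧
    ∃ K : Set (List Ev), K.Nonempty ∧ K ⊆ MTM1 ∧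
      IsControllable K (Lang atkStep) ATTKᶜ ∧
      IsNormalLang K (Lang atkStep) P := by
  refine ⟨⟨_, reach_echoStep_handshake.mono atkStep_of_echoStep⟩,
    fun _ => reach_atkStep_handshake, MTM1 ∩ Lang echoStep,
    ⟨_, ⟨_, reach_echoStep_handshake.mono atkStep_of_echoStep, rfl, rfl⟩,
      _, reach_echoStep_handshake⟩,
    Set.inter_subset_left, isControllable_MTM1_inter_Lang_echoStep,
    isNormalLang_MTM1_inter_Lang_echoStep⟩
end

section
/- The nominal channel-free TCP system G_nom (Peer A and Peer B with timeout, composed with the nominal network) is nonblocking with respect to the marked state in which both peers are at 'closed' and the network is at 'init': for every string s ∈ L(G_nom), there exists a string t such that s·t ∈ L(G_nom) and the global state reached after s·t is (A = closed, B = closed, network = init). Hence, without an attacker, the system never gets stuck outside the 'closed' states (Threat Model 3 is satisfied nominally). -/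
/-- Nominal network transitions as a partial function, the network ignoring private events. -/
def netNextNom : NSt → Ev → Option NSt
  | .init, .an m => some (.qa m)
  | .init, .bn m => some (.qb m)
  | .qa m, .nb m' => if m = m' then some .init else none
  | .qb m, .na m' => if m = m' then some .init else none
  | _, .an _ | _, .na _ | _, .bn _ | _, .nb _ => none
  | n, _ => some n

theorem sync_netTransNom_iff (n : NSt) (e : Ev) (n' : NSt) :
    sync netAlph netTransNom n e n' ↔ netNextNom n e = some n' := by
  cases e <;> cases n <;> simp [sync, netAlph, netTransNom, netNextNom] <;> grind

/-- The moves available in a global state of the nominal system. -/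
def nominalMoves (q : GSt) : List (Ev × GSt) :=
  (peerTrans .an .na .listenA .timeoutA .delA).filterMap (fun t =>
    if t.1 = q.pa then (netNextNom q.net t.2.1).map fun n => (t.2.1, ⟨t.2.2, q.pb, n⟩) else none) ++
  (peerTrans .bn .nb .listenB .timeoutB .delB).filterMap (fun t =>
    if t.1 = q.pb then (netNextNom q.net t.2.1).map fun n => (t.2.1, ⟨q.pa, t.2.2, n⟩) else none)

theorem mem_nominalMoves_iff (q : GSt) (e : Ev) (q' : GSt) :
    (e, q') ∈ nominalMoves q ↔
      (peerAStep q.pa e q'.pa ∧ q'.pb = q.pb ∨ q'.pa = q.pa ∧ peerBStep q.pb e q'.pb) ∧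
        netNextNom q.net e = some q'.net := by
  obtain ⟨a, b, n⟩ := q
  obtain ⟨a', b', n'⟩ := q'
  simp only [nominalMoves, peerAStep, peerBStep, List.mem_append, List.mem_filterMap,
    Option.ite_none_right_eq_some, Option.map_eq_some_iff, Prod.mk.injEq, GSt.mk.injEq,
    Prod.exists]
  grind

theorem gstep_netTransNom_iff (q : GSt) (e : Ev) (q' : GSt) :
    gstep netTransNom q e q' ↔ (e, q') ∈ nominalMoves q := by
  rw [mem_nominalMoves_iff, gstep, sync_netTransNom_iff, ← and_assoc]
  refine and_congr_left fun _ => ?_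
  cases e <;> simp [sync, peerAAlph, peerBAlph, peerAlph, peerAStep, peerBStep, peerTrans]

/-- The global state with the roles of the two peers exchanged. -/
def GSt.swap (q : GSt) : GSt :=
  ⟨q.pb, q.pa, match q.net with | .init => .init | .qa m => .qb m | .qb m => .qa m⟩

/-- The reachable states of the nominal system up to exchanging the peers, ordered by their
distance to `init`. -/
def nominalStatesUpToSwap : List GSt :=
  [⟨.closed, .closed, .init⟩, ⟨.closed, .lastack, .qa .ack⟩, ⟨.closed, .listen, .init⟩,
   ⟨.closed, .timewait, .init⟩, ⟨.lastack, .listen, .qb .ack⟩, ⟨.lastack, .timewait, .qb .ack⟩,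
   ⟨.listen, .listen, .init⟩, ⟨.listen, .timewait, .init⟩, ⟨.i5, .lastack, .init⟩,
   ⟨.finwait2, .lastack, .qb .fin⟩, ⟨.closewait, .finwait2, .init⟩,
   ⟨.closewait, .finwait1, .qa .ack⟩, ⟨.finwait1, .i3, .init⟩,
   ⟨.established, .finwait1, .qb .fin⟩, ⟨.established, .established, .init⟩,
   ⟨.established, .synreceived, .qa .ack⟩, ⟨.i0, .synreceived, .init⟩,
   ⟨.synreceived, .synsent, .qa .synack⟩, ⟨.i2, .synsent, .init⟩, ⟨.listen, .synsent, .qb .syn⟩,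
   ⟨.closed, .synsent, .qb .syn⟩, ⟨.synsent, .timewait, .qa .syn⟩]

/-- The reachable states of the nominal system, ordered by their distance to `init`. -/
def nominalStates : List GSt :=
  nominalStatesUpToSwap.flatMap fun q => [q, q.swap]

theorem nominalMoves_subset_nominalStates :
    ∀ q ∈ nominalStates, ∀ p ∈ nominalMoves q, p.2 ∈ nominalStates := by
  decide +kernel

theorem exists_mem_nominalMoves_idxOf_lt : ∀ q ∈ nominalStates, q ≠ init →
    ∃ p ∈ nominalMoves q, nominalStates.idxOf p.2 < nominalStates.idxOf q := by
  decide +kernel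

theorem Reach.mem_nominalStates {s : List Ev} {q : GSt}
    (h : Reach (gstep netTransNom) init s q) : q ∈ nominalStates := by
  induction h with
  | nil => decide
  | snoc _ hstep ih =>
    exact nominalMoves_subset_nominalStates _ ih _ ((gstep_netTransNom_iff _ _ _).1 hstep)

theorem Reach.exists_append_init {s : List Ev} {q : GSt}
    (h : Reach (gstep netTransNom) init s q) :
    ∃ t, Reach (gstep netTransNom) init (s ++ t) init := by
  by_cases hq : q = init
  · exact ⟨[], by simpa [hq] using h⟩
  · obtain ⟨⟨e, q'⟩, he, hlt⟩ := exists_mem_nominalMoves_idxOf_lt q h.mem_nominalStates hq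
    obtain ⟨t, ht⟩ := (h.snoc ((gstep_netTransNom_iff q e q').2 he)).exists_append_init
    exact ⟨e :: t, by simpa using ht⟩
termination_by nominalStates.idxOf q

/-- the nominal channel-free TCP system `G_nom` is nonblocking w.r.t.
the marked state `(A = closed, B = closed, network = init)`: every generated string can
be extended within `L(G_nom)` to a string leading back to that state.  Hence, without an
attacker, the system never gets stuck outside the `closed` states (Threat Model 3 holds
nominally). -/
theorem stmt19 (s : List Ev) (hs : s ∈ Lang (gstep netTransNom)) :
    ∃ t : List Ev, Reach (gstep netTransNom) init (s ++ t) init := by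
  obtain ⟨q, h⟩ := hs
  exact h.exists_append_init
end
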